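/- Let 0 < a < ∞ and let x : (-a,a) → ℂ be differentiable on (-a,a) with derivative x' absolutely continuous on every compact subinterval of (-a,a), and suppose ∫_{-a}^{a} | (d/dξ)( (1 - ξ²/a²) x'(ξ) ) | dξ < ∞. Then x(ξ) = O(|ln|ξ+a||) as ξ → -a and x(ξ) = O(|ln|ξ-a||) as ξ → a; consequently ∫_{-a}^{a} |x(ξ)| dξ < ∞, and (ξ+a)·x(ξ) → 0 as ξ → -a⁺ and (ξ-a)·x(ξ) → 0 as ξ → a⁻. -/

import Mathlib

open MeasureTheory Complex Filter Asymptotics Topology intervalIntegral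

/-- If `‖f'(t)‖ ≤ M / (a - t)` on `[0, a)`, then `f` grows at most logarithmically at `a`. -/
theorem norm_le_of_norm_deriv_le_div_sub {E : Type*} [NormedAddCommGroup E] [NormedSpace ℝ E]
    {a M : ℝ} {f f' : ℝ → E}
    (hf : ∀ t ∈ Set.Ico 0 a, HasDerivAt f (f' t) t)
    (hM : ∀ t ∈ Set.Ico 0 a, ‖f' t‖ ≤ M / (a - t)) {t : ℝ} (ht : t ∈ Set.Ico 0 a) :
    ‖f t‖ ≤ ‖f 0‖ + M * (Real.log a - Real.log (a - t)) := by
  have hsub : ∀ s ∈ Set.Icc 0 t, s ∈ Set.Ico 0 a := fun s hs => ⟨hs.1, hs.2.trans_lt ht.2⟩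
  have hB : ∀ s ∈ Set.Icc 0 t,
      HasDerivAt (fun s => ‖f 0‖ + M * (Real.log a - Real.log (a - s))) (M / (a - s)) s := by
    intro s hs
    have hs' : a - s ≠ 0 := (sub_pos.2 (hsub s hs).2).ne'
    have h := (((((hasDerivAt_id s).const_sub a).log hs').const_sub
      (Real.log a)).const_mul M).const_add ‖f 0‖
    refine h.congr_deriv ?_
    simp only [id_eq]
    ring
  refine image_norm_le_of_norm_deriv_right_le_deriv_boundary'
    (fun s hs => (hf s (hsub s hs)).continuousAt.continuousWithinAt)
    (fun s hs => (hf s (hsub s (Set.Ico_subset_Icc_self hs))).hasDerivWithinAt) (by simp)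
    (fun s hs => (hB s hs).continuousAt.continuousWithinAt)
    (fun s hs => (hB s (Set.Ico_subset_Icc_self hs)).hasDerivWithinAt)
    (fun s hs => hM s (hsub s (Set.Ico_subset_Icc_self hs))) ⟨ht.1, le_rfl⟩

/-- An affine bound in `|log |u||` is a big-O bound by `log |u|` where `u → 0`, `u ≠ 0`. -/
theorem isBigO_log_abs_of_norm_le {α E : Type*} [NormedAddCommGroup E] {l : Filter α} {u : α → ℝ}
    {f : α → E} {K M : ℝ} (hu : Tendsto u l (𝓝[≠] 0))
    (hf : ∀ᶠ t in l, ‖f t‖ ≤ K + M * |Real.log (|u t|)|) :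
    f =O[l] fun t => Real.log |u t| := by
  have hlog : Tendsto (fun t => |Real.log (|u t|)|) l atTop := by
    simp only [Real.log_abs]
    exact tendsto_abs_atBot_atTop.comp (Real.tendsto_log_nhdsNE_zero.comp hu)
  refine IsBigO.of_bound (|K| + M) ?_
  filter_upwards [hf, hlog.eventually_ge_atTop 1] with t ht h1
  rw [Real.norm_eq_abs]
  nlinarith [le_abs_self K, abs_nonneg K]

/-- If `f = O(log |u|)` and `u → 0`, then `u * f → 0`. -/
theorem tendsto_ofReal_mul_zero_of_isBigO_log {α : Type*} {l : Filter α} {u : α → ℝ}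
    {f : α → ℂ} (hu : Tendsto u l (𝓝 0)) (hf : f =O[l] fun t => Real.log |u t|) :
    Tendsto (fun t => (u t : ℂ) * f t) l (𝓝 0) := by
  have h1 : (fun t => (u t : ℂ)) =O[l] u := IsBigO.of_bound 1 (by simp)
  refine (h1.mul hf).trans_tendsto ?_
  have h := (Real.continuous_mul_log.tendsto 0).comp hu
  simpa [Function.comp_def, Real.log_abs] using h

/-- Let `0 < a < ∞` and let `x : (-a,a) → ℂ` be differentiable with derivative `x'` such that
`ξ ↦ (1 - ξ²/a²) x'(ξ)` is absolutely continuous with a.e. derivative `g`, and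
`∫_{-a}^{a} |g| < ∞`. Then `x(ξ) = O(|ln|ξ+a||)` as `ξ → -a` and `x(ξ) = O(|ln|ξ-a||)` as
`ξ → a`; consequently `x` is summable on `(-a,a)` and `(ξ+a)x(ξ) → 0` as `ξ → -a⁺`,
`(ξ-a)x(ξ) → 0` as `ξ → a⁻`. -/
theorem log_bound_and_boundary_vanishing_on_symmetric_interval
    (a : ℝ) (ha : 0 < a) (x x' g : ℝ → ℂ)
    (hderiv : ∀ t ∈ Set.Ioo (-a) a, HasDerivAt x (x' t) t)
    (hac : ∀ α β : ℝ, -a < α → α ≤ β → β < a →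
      (1 - (β : ℂ) ^ 2 / (a : ℂ) ^ 2) * x' β - (1 - (α : ℂ) ^ 2 / (a : ℂ) ^ 2) * x' α
        = ∫ ξ in α..β, g ξ)
    (hg : IntegrableOn g (Set.Ioo (-a) a)) :
    (x =O[𝓝[Set.Ioo (-a) a] (-a)] fun ξ : ℝ => Real.log |ξ + a|) ∧
    (x =O[𝓝[Set.Ioo (-a) a] a] fun ξ : ℝ => Real.log |ξ - a|) ∧
    IntegrableOn x (Set.Ioo (-a) a) ∧
    Tendsto (fun ξ : ℝ => ((ξ + a : ℝ) : ℂ) * x ξ) (𝓝[Set.Ioo (-a) a] (-a)) (nhds 0) ∧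
    Tendsto (fun ξ : ℝ => ((ξ - a : ℝ) : ℂ) * x ξ) (𝓝[Set.Ioo (-a) a] a) (nhds 0) := by
  obtain ⟨C, hC⟩ : ∃ C : ℝ, ∀ t ∈ Set.Ioo (-a) a,
      ‖(1 - (t : ℂ) ^ 2 / (a : ℂ) ^ 2) * x' t‖ ≤ C := by
    have hint : ∀ α β : ℝ, -a < α → α ≤ β → β < a →
        ‖∫ ξ in α..β, g ξ‖ ≤ ∫ ξ in Set.Ioo (-a) a, ‖g ξ‖ := by
      intro α β hα hαβ hβ
      rw [integral_of_le hαβ]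
      refine (MeasureTheory.norm_integral_le_integral_norm _).trans
        (setIntegral_mono_set hg.norm (ae_of_all _ fun _ => norm_nonneg _) ?_)
      exact LE.le.eventuallyLE fun s hs => ⟨hα.trans hs.1, hs.2.trans_lt hβ⟩
    refine ⟨‖x' 0‖ + ∫ ξ in Set.Ioo (-a) a, ‖g ξ‖, fun t ht => ?_⟩
    rcases le_total 0 t with h0 | h0
    · have h := hac 0 t (by linarith) h0 ht.2
      have h' := hint 0 t (by linarith) h0 ht.2
      rw [← h] at h'
      have := norm_le_norm_add_norm_sub' ((1 - (t : ℂ) ^ 2 / (a : ℂ) ^ 2) * x' t) (x' 0)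
      simp only [ofReal_zero, ne_eq, OfNat.ofNat_ne_zero, not_false_eq_true, zero_pow, zero_div,
        sub_zero, one_mul] at h'
      linarith
    · have h := hac t 0 ht.1 h0 ha
      have h' := hint t 0 ht.1 h0 ha
      rw [← h] at h'
      simp only [ofReal_zero, ne_eq, OfNat.ofNat_ne_zero, not_false_eq_true, zero_pow, zero_div,
        sub_zero, one_mul] at h'
      rw [norm_sub_rev] at h'
      have := norm_le_norm_add_norm_sub' ((1 - (t : ℂ) ^ 2 / (a : ℂ) ^ 2) * x' t) (x' 0)
      linarith
  have hC0 : 0 ≤ C := (norm_nonneg _).trans (hC 0 ⟨by linarith, ha⟩)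
  have hx' : ∀ t ∈ Set.Ioo (-a) a, ‖x' t‖ ≤ C * a / (a - |t|) := by
    intro t ht
    have hta : |t| < a := abs_lt.2 ht
    have h := hC t ht
    have hcast : (1 - (t : ℂ) ^ 2 / (a : ℂ) ^ 2) = ((1 - t ^ 2 / a ^ 2 : ℝ) : ℂ) := by
      push_cast; rfl
    have hfac : (1 - t ^ 2 / a ^ 2 : ℝ) = (a - |t|) * (a + |t|) / a ^ 2 := by
      rw [← sq_abs t]
      field_simp
      ring
    have hge : (a - |t|) / a ≤ 1 - t ^ 2 / a ^ 2 := by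
      rw [hfac, div_le_div_iff₀ ha (by positivity)]
      have : 0 ≤ (a - |t|) * |t| * a := by
        have := sub_nonneg.2 hta.le
        positivity
      nlinarith
    have hpos : 0 < (a - |t|) / a := div_pos (sub_pos.2 hta) ha
    rw [hcast, norm_mul, norm_real, Real.norm_eq_abs, abs_of_pos (hpos.trans_le hge)] at h
    rw [← div_div_eq_mul_div, le_div_iff₀ hpos, mul_comm]
    exact (mul_le_mul_of_nonneg_right hge (norm_nonneg _)).trans h
  set M := C * a with hM
  have hM0 : 0 ≤ M := mul_nonneg hC0 ha.le
  set K := ‖x 0‖ + M * Real.log a with hK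
  have hright : ∀ t ∈ Set.Ico 0 a, ‖x t‖ ≤ K + M * |Real.log (|t - a|)| := by
    intro t ht
    have h := norm_le_of_norm_deriv_le_div_sub (f := x) (f' := x') (M := M)
      (fun s hs => hderiv s ⟨by linarith [hs.1], hs.2⟩)
      (fun s hs => by simpa [abs_of_nonneg hs.1] using hx' s ⟨by linarith [hs.1], hs.2⟩) ht
    rw [abs_sub_comm, Real.log_abs]
    nlinarith [neg_abs_le (Real.log (a - t))]
  have hleft : ∀ t ∈ Set.Ioc (-a) 0, ‖x t‖ ≤ K + M * |Real.log (|t + a|)| := by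
    intro t ht
    have h := norm_le_of_norm_deriv_le_div_sub (f := fun s => x (-s)) (f' := fun s => -x' (-s))
      (a := a) (M := M) (t := -t)
      (fun s hs => by
        simpa [Function.comp_def] using
          (hderiv (-s) ⟨by linarith [hs.2], by linarith [hs.1]⟩).scomp s (hasDerivAt_neg s))
      (fun s hs => by
        simpa [abs_of_nonneg hs.1] using hx' (-s) ⟨by linarith [hs.2], by linarith [hs.1]⟩)
      ⟨by linarith [ht.2], by linarith [ht.1]⟩
    simp only [neg_neg, neg_zero, sub_neg_eq_add] at h
    rw [add_comm t, Real.log_abs]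
    nlinarith [neg_abs_le (Real.log (a + t))]
  have hul : Tendsto (fun ξ : ℝ => ξ + a) (𝓝[Set.Ioo (-a) a] (-a)) (𝓝[≠] 0) := by
    refine tendsto_nhdsWithin_iff.2 ⟨?_, ?_⟩
    · exact (Continuous.tendsto' (by fun_prop) _ _ (by simp)).mono_left nhdsWithin_le_nhds
    · filter_upwards [self_mem_nhdsWithin] with t ht
      exact (by linarith [ht.1] : 0 < t + a).ne'
  have hur : Tendsto (fun ξ : ℝ => ξ - a) (𝓝[Set.Ioo (-a) a] a) (𝓝[≠] 0) := by
    refine tendsto_nhdsWithin_iff.2 ⟨?_, ?_⟩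
    · exact (Continuous.tendsto' (by fun_prop) _ _ (by simp)).mono_left nhdsWithin_le_nhds
    · filter_upwards [self_mem_nhdsWithin] with t ht
      exact (by linarith [ht.2] : t - a < 0).ne
  have hOl : x =O[𝓝[Set.Ioo (-a) a] (-a)] fun ξ : ℝ => Real.log |ξ + a| := by
    refine isBigO_log_abs_of_norm_le hul (K := K) (M := M) ?_
    filter_upwards [self_mem_nhdsWithin,
      mem_nhdsWithin_of_mem_nhds (Iio_mem_nhds (neg_neg_of_pos ha))] with t ht ht'
    exact hleft t ⟨ht.1, le_of_lt ht'⟩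
  have hOr : x =O[𝓝[Set.Ioo (-a) a] a] fun ξ : ℝ => Real.log |ξ - a| := by
    refine isBigO_log_abs_of_norm_le hur (K := K) (M := M) ?_
    filter_upwards [self_mem_nhdsWithin,
      mem_nhdsWithin_of_mem_nhds (Ioi_mem_nhds ha)] with t ht ht'
    exact hright t ⟨le_of_lt ht', ht.2⟩
  refine ⟨hOl, hOr, ?_,
    tendsto_ofReal_mul_zero_of_isBigO_log (hul.mono_right nhdsWithin_le_nhds) hOl,
    tendsto_ofReal_mul_zero_of_isBigO_log (hur.mono_right nhdsWithin_le_nhds) hOr⟩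
  have hmeas : AEStronglyMeasurable x (volume.restrict (Set.Ioo (-a) a)) :=
    ContinuousOn.aestronglyMeasurable
      (fun t ht => (hderiv t ht).continuousAt.continuousWithinAt) measurableSet_Ioo
  have hlogl : IntervalIntegrable (fun t => Real.log (t + a)) volume (-a) a := by
    simpa using (intervalIntegrable_log' (a := -a + a) (b := a + a)).comp_add_right a
  have hlogr : IntervalIntegrable (fun t => Real.log (t - a)) volume (-a) a := by
    simpa using (intervalIntegrable_log' (a := -a - a) (b := a - a)).comp_sub_right a
  have hbound : IntegrableOn (fun t => K + M * |Real.log (|t + a|)| + M * |Real.log (|t - a|)|)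
      (Set.Ioo (-a) a) := by
    simp only [Real.log_abs]
    refine IntegrableOn.mono_set ?_ Set.Ioo_subset_Ioc_self
    exact (intervalIntegrable_iff_integrableOn_Ioc_of_le (by linarith)).1
      ((intervalIntegrable_const.add (hlogl.abs.const_mul M)).add (hlogr.abs.const_mul M))
  refine Integrable.mono' hbound hmeas ?_
  filter_upwards [ae_restrict_mem measurableSet_Ioo] with t ht
  have h1 : 0 ≤ M * |Real.log (|t + a|)| := by positivity
  have h2 : 0 ≤ M * |Real.log (|t - a|)| := by positivity
  rcases le_total 0 t with h0 | h0
  · linarith [hright t ⟨h0, ht.2⟩]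
  · linarith [hleft t ⟨ht.1, h0⟩]
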